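/- Let b : ℝ³ × S² → [0,∞) be measurable with b ∈ L¹(ℝ³ × S²) and b(w,ω) = q(|w|,|w·ω|) for some measurable q. Let f₀ be measurable with 0 ≤ f₀ ≤ 1 a.e. and f₀ ∈ L¹(ℝ³ × ℝ³), and let f be the unique mild solution of the Boltzmann–Fermi–Dirac equation with initial datum f₀ satisfying 0 ≤ f ≤ 1 a.e. Then t ↦ f(t,·,·) belongs to C⁰([0,∞); L¹(ℝ³ × ℝ³)) and the total mass is conserved: ∫∫_{ℝ³×ℝ³} f(t,x,v) dx dv = ∫∫_{ℝ³×ℝ³} f₀(x,v) dx dv for all t ≥ 0. -/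

import Mathlib

open MeasureTheory Metric
open scoped RealInnerProductSpace ENNReal

noncomputable section

/-- Euclidean space `ℝ³`. -/
abbrev R3 : Type := EuclideanSpace ℝ (Fin 3)

/-- The unit sphere `S² ⊂ ℝ³`. -/
abbrev S2 : Type := sphere (0 : R3) 1

/-- The surface measure on the unit sphere `S²`. -/
def sphMeasure : Measure S2 := (volume : Measure R3).toSphere

/-- The precollisional velocity `v' = v - ((v - v*)·ω) ω`. -/
def vPrime (v vs : R3) (ω : S2) : R3 := v - ⟪v - vs, (ω : R3)⟫ • (ω : R3)

/-- The precollisional velocity `v*' = v* + ((v - v*)·ω) ω`. -/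
def vsPrime (v vs : R3) (ω : S2) : R3 := vs + ⟪v - vs, (ω : R3)⟫ • (ω : R3)

/-- The Boltzmann–Fermi–Dirac collision operator with collision kernel `b`:
`Q(f)(v) = ∫_{S²} ∫_{ℝ³} b(v - v*, ω) [f' f*' (1-f)(1-f*) - f f* (1-f')(1-f*')] dv* dω`. -/
def Qcoll (b : R3 × S2 → ℝ) (f : R3 → ℝ) (v : R3) : ℝ :=
  ∫ ω : S2, ∫ vs : R3,
      b (v - vs, ω) *
        (f (vPrime v vs ω) * f (vsPrime v vs ω) * (1 - f v) * (1 - f vs)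
          - f v * f vs * (1 - f (vPrime v vs ω)) * (1 - f (vsPrime v vs ω)))
    ∂(volume : Measure R3) ∂sphMeasure
/-- `f` is a mild solution of the Boltzmann–Fermi–Dirac equation with initial datum `f₀`. -/
def IsMildSolution (b : R3 × S2 → ℝ) (f₀ : R3 × R3 → ℝ) (f : ℝ × R3 × R3 → ℝ) : Prop :=
  ∀ᵐ q : R3 × R3 ∂(volume : Measure (R3 × R3)), ∀ t : ℝ, 0 ≤ t →
    f (t, q.1 + t • q.2, q.2) =
      f₀ q + ∫ s in (0 : ℝ)..t, Qcoll b (fun w => f (s, q.1 + s • q.2, w)) q.2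

instance instFinSph : IsFiniteMeasure sphMeasure := by unfold sphMeasure; infer_instance

/-- The collision map for fixed `ω`. -/
def Tcoll (ω : S2) (p : R3 × R3) : R3 × R3 := (vPrime p.1 p.2 ω, vsPrime p.1 p.2 ω)

lemma inner_sph (ω : S2) : ⟪(ω : R3), (ω : R3)⟫ = 1 := by
  have h : ‖(ω : R3)‖ = 1 := by simp
  rw [real_inner_self_eq_norm_sq, h]; norm_num

lemma prime_sub (v vs : R3) (ω : S2) :
    vPrime v vs ω - vsPrime v vs ω = (v - vs) - (2 * ⟪v - vs, (ω : R3)⟫) • (ω : R3) := by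
  unfold vPrime vsPrime
  module

lemma inner_prime (v vs : R3) (ω : S2) :
    ⟪vPrime v vs ω - vsPrime v vs ω, (ω : R3)⟫ = - ⟪v - vs, (ω : R3)⟫ := by
  rw [prime_sub, inner_sub_left, real_inner_smul_left, inner_sph]; ring

lemma norm_prime (v vs : R3) (ω : S2) :
    ‖vPrime v vs ω - vsPrime v vs ω‖ = ‖v - vs‖ := by
  have h : ‖vPrime v vs ω - vsPrime v vs ω‖ ^ 2 = ‖v - vs‖ ^ 2 := by
    rw [prime_sub, norm_sub_sq_real, real_inner_smul_right, norm_smul]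
    have h : ‖(ω : R3)‖ = 1 := by simp
    rw [h, mul_one, Real.norm_eq_abs, sq_abs]; ring
  exact (sq_eq_sq₀ (norm_nonneg _) (norm_nonneg _)).1 h

lemma Tcoll_invol (ω : S2) (p : R3 × R3) : Tcoll ω (Tcoll ω p) = p := by
  have h := inner_prime p.1 p.2 ω
  have e1 : vPrime (vPrime p.1 p.2 ω) (vsPrime p.1 p.2 ω) ω = p.1 := by
    conv_lhs => unfold vPrime
    rw [show p.1 - ⟪p.1 - p.2, (ω : R3)⟫ • (ω : R3) = vPrime p.1 p.2 ω from rfl, h]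
    unfold vPrime; module
  have e2 : vsPrime (vPrime p.1 p.2 ω) (vsPrime p.1 p.2 ω) ω = p.2 := by
    conv_lhs => unfold vsPrime
    rw [show p.2 + ⟪p.1 - p.2, (ω : R3)⟫ • (ω : R3) = vsPrime p.1 p.2 ω from rfl, h]
    unfold vsPrime; module
  exact Prod.ext e1 e2

/-- The collision map as a linear map. -/
def TcollL (ω : S2) : R3 × R3 →ₗ[ℝ] R3 × R3 where
  toFun := Tcoll ω
  map_add' p q := by
    simp only [Tcoll, vPrime, vsPrime, Prod.fst_add, Prod.snd_add, Prod.mk_add_mk]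
    rw [show p.1 + q.1 - (p.2 + q.2) = (p.1 - p.2) + (q.1 - q.2) by abel, inner_add_left]
    ext1 <;> simp only <;> module
  map_smul' c p := by
    simp only [Tcoll, vPrime, vsPrime, Prod.smul_fst, Prod.smul_snd, Prod.smul_mk, RingHom.id_apply]
    rw [← smul_sub, real_inner_smul_left]
    ext1 <;> simp only <;> module

lemma vPrime_meas : Measurable (fun p : S2 × R3 × R3 => vPrime p.2.1 p.2.2 p.1) := by
  unfold vPrime; fun_prop

lemma vsPrime_meas : Measurable (fun p : S2 × R3 × R3 => vsPrime p.2.1 p.2.2 p.1) := by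
  unfold vsPrime; fun_prop

lemma Measurable.vPrime' {α : Type*} [MeasurableSpace α] {f g : α → R3} {h : α → S2}
    (hf : Measurable f) (hg : Measurable g) (hh : Measurable h) :
    Measurable fun a => vPrime (f a) (g a) (h a) :=
  vPrime_meas.comp (hh.prodMk (hf.prodMk hg))

lemma Measurable.vsPrime' {α : Type*} [MeasurableSpace α] {f g : α → R3} {h : α → S2}
    (hf : Measurable f) (hg : Measurable g) (hh : Measurable h) :
    Measurable fun a => vsPrime (f a) (g a) (h a) :=
  vsPrime_meas.comp (hh.prodMk (hf.prodMk hg))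

lemma Tcoll_meas (ω : S2) : Measurable (Tcoll ω) :=
  (Measurable.vPrime' measurable_fst measurable_snd measurable_const).prodMk
    (Measurable.vsPrime' measurable_fst measurable_snd measurable_const)

lemma Tcoll_mp (ω : S2) : MeasurePreserving (Tcoll ω)
    ((volume : Measure R3).prod (volume : Measure R3))
    ((volume : Measure R3).prod (volume : Measure R3)) := by
  refine ⟨Tcoll_meas ω, ?_⟩
  have hcomp : (TcollL ω) ∘ₗ (TcollL ω) = LinearMap.id := by
    ext1 <;> ext1 x <;> exact Tcoll_invol ω _
  have hd : LinearMap.det (TcollL ω) * LinearMap.det (TcollL ω) = 1 := by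
    rw [← LinearMap.det_comp, hcomp, LinearMap.det_id]
  have hne : LinearMap.det (TcollL ω) ≠ 0 := by
    intro h; rw [h] at hd; norm_num at hd
  have habs : |(LinearMap.det (TcollL ω))⁻¹| = 1 := by
    rw [abs_inv]
    rcases mul_self_eq_one_iff.1 hd with h | h <;> rw [h] <;> norm_num
  have := Measure.map_linearMap_addHaar_eq_smul_addHaar
    ((volume : Measure R3).prod (volume : Measure R3)) hne
  rw [habs, ENNReal.ofReal_one, one_smul] at this
  exact this

/-- The free transport map. -/
def Sfree (t : ℝ) (p : R3 × R3) : R3 × R3 := (p.1 + t • p.2, p.2)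

lemma Sfree_meas (t : ℝ) : Measurable (Sfree t) := by unfold Sfree; fun_prop

lemma Sfree_mp (t : ℝ) : MeasurePreserving (Sfree t)
    (volume : Measure (R3 × R3)) (volume : Measure (R3 × R3)) := by
  have h1 : MeasurePreserving (fun p : R3 × R3 => (p.1, p.2 + t • p.1))
      ((volume : Measure R3).prod (volume : Measure R3))
      ((volume : Measure R3).prod (volume : Measure R3)) := by
    refine (MeasurePreserving.id (volume : Measure R3)).skew_product (g := fun a c => c + t • a)
      (by unfold Function.uncurry; fun_prop) ?_
    exact Filter.Eventually.of_forall fun a => map_add_right_eq_self _ _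
  rw [Measure.volume_eq_prod]
  exact (Measure.measurePreserving_swap.comp h1).comp Measure.measurePreserving_swap

lemma Sfree_emb (t : ℝ) : MeasurableEmbedding (Sfree t) := by
  have : Sfree t = (⟨⟨Sfree t, Sfree (-t), fun p => by simp [Sfree], fun p => by simp [Sfree]⟩,
    Sfree_meas t, Sfree_meas (-t)⟩ : (R3 × R3) ≃ᵐ (R3 × R3)) := rfl
  rw [this]
  exact MeasurableEquiv.measurableEmbedding _

lemma Tcoll_emb (ω : S2) : MeasurableEmbedding (Tcoll ω) := by
  have : Tcoll ω = (⟨⟨Tcoll ω, Tcoll ω, Tcoll_invol ω, Tcoll_invol ω⟩,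
    Tcoll_meas ω, Tcoll_meas ω⟩ : (R3 × R3) ≃ᵐ (R3 × R3)) := rfl
  rw [this]
  exact MeasurableEquiv.measurableEmbedding _

/-- Space-time transport. -/
lemma SST_mp (A : Set ℝ) : MeasurePreserving (fun p : ℝ × R3 × R3 => (p.1, Sfree p.1 p.2))
    (((volume : Measure ℝ).restrict A).prod (volume : Measure (R3 × R3)))
    (((volume : Measure ℝ).restrict A).prod (volume : Measure (R3 × R3))) := by
  refine (MeasurePreserving.id _).skew_product (g := fun s p => Sfree s p)
      (by unfold Function.uncurry Sfree; fun_prop) ?_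
  exact Filter.Eventually.of_forall fun a => (Sfree_mp a).map_eq

/-- The symmetry assumption on the kernel. -/
def KSym (b : R3 × S2 → ℝ) : Prop := ∀ (v vs : R3) (ω : S2),
  b (vPrime v vs ω - vsPrime v vs ω, ω) = b (v - vs, ω)

/-- A linear majorant of the collision operator. -/
def Aop (b : R3 × S2 → ℝ) (p : R3 → ℝ≥0∞) (v : R3) : ℝ≥0∞ :=
  ∫⁻ ω : S2, ∫⁻ vs : R3, ENNReal.ofReal (b (v - vs, ω)) * (p (vPrime v vs ω) + p v)
    ∂(volume : Measure R3) ∂sphMeasure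

/-- The mass of the kernel. -/
def Bn (b : R3 × S2 → ℝ) : ℝ≥0∞ := ∫⁻ x, ENNReal.ofReal (b x) ∂((volume : Measure R3).prod sphMeasure)

lemma lint_b {b : R3 × S2 → ℝ} (hb : Measurable b) (v : R3) :
    ∫⁻ ω : S2, ∫⁻ vs : R3, ENNReal.ofReal (b (v - vs, ω)) ∂(volume : Measure R3) ∂sphMeasure
      = Bn b := by
  unfold Bn
  rw [lintegral_prod_symm _ (by fun_prop)]
  refine lintegral_congr fun ω => ?_
  exact lintegral_sub_left_eq_self (fun x => ENNReal.ofReal (b (x, ω))) v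

lemma Aop_mono {b : R3 × S2 → ℝ} {p q : R3 → ℝ≥0∞} (h : ∀ v, p v ≤ q v) (v : R3) :
    Aop b p v ≤ Aop b q v := by
  unfold Aop
  refine lintegral_mono fun ω => lintegral_mono fun vs => ?_
  dsimp only
  gcongr <;> exact h _

lemma lint_b_const {b : R3 × S2 → ℝ} (hb : Measurable b) (v : R3) (c : ℝ≥0∞) :
    ∫⁻ ω : S2, ∫⁻ vs : R3, ENNReal.ofReal (b (v - vs, ω)) * c ∂(volume : Measure R3) ∂sphMeasure
      = Bn b * c := by
  rw [← lint_b hb v, ← lintegral_mul_const _ (by fun_prop)]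
  refine lintegral_congr fun ω => ?_
  rw [← lintegral_mul_const _ (by fun_prop)]

lemma Aop_trunc {b : R3 × S2 → ℝ} (hb : Measurable b) (p : R3 → ℝ≥0∞) (c : ℝ≥0∞)
    (v : R3) :
    Aop b p v ≤ Aop b (fun w => p w - c) v + 2 * Bn b * c := by
  have h2 : 2 * Bn b * c = ∫⁻ ω : S2, ∫⁻ vs : R3, ENNReal.ofReal (b (v - vs, ω)) * (c + c)
      ∂(volume : Measure R3) ∂sphMeasure := by
    rw [lint_b_const hb]; ring
  rw [h2]
  unfold Aop
  rw [← lintegral_add_right _ (by fun_prop)]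
  refine lintegral_mono fun ω => ?_
  dsimp only
  rw [← lintegral_add_right _ (by fun_prop)]
  refine lintegral_mono fun vs => ?_
  dsimp only
  rw [← mul_add]
  refine mul_le_mul' le_rfl ?_
  calc p (vPrime v vs ω) + p v ≤ (p (vPrime v vs ω) - c + c) + (p v - c + c) := by
        gcongr <;> exact le_tsub_add
    _ = _ := by ring

lemma Aop_le {b : R3 × S2 → ℝ} (hb : Measurable b) {p : R3 → ℝ≥0∞} (h : ∀ v, p v ≤ 1) (v : R3) :
    Aop b p v ≤ 2 * Bn b := by
  calc Aop b p v ≤ ∫⁻ ω : S2, ∫⁻ vs : R3, ENNReal.ofReal (b (v - vs, ω)) * (1 + 1)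
      ∂(volume : Measure R3) ∂sphMeasure := by
        unfold Aop
        refine lintegral_mono fun ω => lintegral_mono fun vs => ?_
        dsimp only
        gcongr <;> exact h _
    _ = _ := by rw [lint_b_const hb]; ring

lemma Aop_meas {Y : Type*} [MeasurableSpace Y] {b : R3 × S2 → ℝ} (hb : Measurable b)
    {p : Y × R3 → ℝ≥0∞} (hp : Measurable p) :
    Measurable (fun y : Y × R3 => Aop b (fun w => p (y.1, w)) y.2) := by
  unfold Aop
  refine Measurable.lintegral_prod_right (f := fun (y : Y × R3) (ω : S2) => ∫⁻ vs : R3, ENNReal.ofReal (b (y.2 - vs, ω)) * (p (y.1, vPrime y.2 vs ω) + p (y.1, y.2)) ∂(volume : Measure R3)) ?_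
  unfold Function.uncurry
  refine Measurable.lintegral_prod_right (f := fun (z : (Y × R3) × S2) (vs : R3) => ENNReal.ofReal (b (z.1.2 - vs, z.2)) * (p (z.1.1, vPrime z.1.2 vs z.2) + p (z.1.1, z.1.2))) ?_
  unfold Function.uncurry
  have h1 : Measurable fun q : ((Y × R3) × S2) × R3 => vPrime q.1.1.2 q.2 q.1.2 :=
    Measurable.vPrime' (by fun_prop) (by fun_prop) (by fun_prop)
  fun_prop

lemma lint_Aop {b : R3 × S2 → ℝ} (hb : Measurable b) (hs : KSym b) {p : R3 → ℝ≥0∞}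
    (hp : Measurable p) : ∫⁻ v, Aop b p v = 2 * Bn b * ∫⁻ v, p v := by
  have h1 : Measurable fun q : (R3 × S2) × R3 => vPrime q.1.1 q.2 q.1.2 :=
    Measurable.vPrime' (by fun_prop) (by fun_prop) (by fun_prop)
  have h2 : ∀ ω : S2, Measurable fun q : R3 × R3 => vPrime q.1 q.2 ω := fun ω =>
    Measurable.vPrime' (by fun_prop) (by fun_prop) (by fun_prop)
  unfold Aop
  rw [lintegral_lintegral_swap]
  swap
  · refine Measurable.aemeasurable ?_
    unfold Function.uncurry
    refine Measurable.lintegral_prod_right (f := fun (z : R3 × S2) (vs : R3) => ENNReal.ofReal (b (z.1 - vs, z.2)) * (p (vPrime z.1 vs z.2) + p (z.1))) ?_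
    unfold Function.uncurry
    fun_prop
  have key : ∀ ω : S2, ∫⁻ v, ∫⁻ vs, ENNReal.ofReal (b (v - vs, ω)) * (p (vPrime v vs ω) + p v)
      = 2 * ∫⁻ v, ∫⁻ vs, ENNReal.ofReal (b (v - vs, ω)) * p v := by
    intro ω
    have := h2 ω
    have e1 : ∫⁻ v, ∫⁻ vs, ENNReal.ofReal (b (v - vs, ω)) * p (vPrime v vs ω)
        = ∫⁻ v, ∫⁻ vs, ENNReal.ofReal (b (v - vs, ω)) * p v := by
      rw [lintegral_lintegral (f := fun v vs => ENNReal.ofReal (b (v - vs, ω)) * p (vPrime v vs ω))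
        (by fun_prop),
        lintegral_lintegral (f := fun v vs => ENNReal.ofReal (b (v - vs, ω)) * p v)
        (by fun_prop), ← (Tcoll_mp ω).lintegral_comp (by fun_prop)]
      refine lintegral_congr fun z => ?_
      have hz : vPrime (vPrime z.1 z.2 ω) (vsPrime z.1 z.2 ω) ω = z.1 :=
        congrArg Prod.fst (Tcoll_invol ω z)
      simp only [Tcoll]
      rw [hs, hz]
    rw [two_mul]
    conv_rhs => enter [1]; rw [← e1]
    rw [← lintegral_add_right _ (by fun_prop)]
    refine lintegral_congr fun v => ?_
    rw [← lintegral_add_right _ (by fun_prop)]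
    simp only [mul_add]
  simp_rw [key]
  rw [lintegral_const_mul _ (by fun_prop), ← lintegral_lintegral_swap (f := fun v ω => ∫⁻ vs, ENNReal.ofReal (b (v - vs, ω)) * p v) (by fun_prop)]
  simp_rw [lint_b_const hb]
  rw [lintegral_const_mul _ hp, mul_assoc]

lemma bracket_le {x y z w : ℝ} (hx : 0 ≤ x ∧ x ≤ 1) (hy : 0 ≤ y ∧ y ≤ 1) (hz : 0 ≤ z ∧ z ≤ 1)
    (hw : 0 ≤ w ∧ w ≤ 1) : |x * y * (1 - z) * (1 - w) - z * w * (1 - x) * (1 - y)| ≤ x + z := by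
  have a : 0 ≤ x * y * (1 - z) * (1 - w) := by
    have := hx.1; have := hy.1; have := sub_nonneg.2 hz.2; have := sub_nonneg.2 hw.2; positivity
  have a' : 0 ≤ z * w * (1 - x) * (1 - y) := by
    have := hz.1; have := hw.1; have := sub_nonneg.2 hx.2; have := sub_nonneg.2 hy.2; positivity
  have c : x * y * (1 - z) * (1 - w) ≤ x := by
    calc x * y * (1 - z) * (1 - w) = x * (y * ((1 - z) * (1 - w))) := by ring
      _ ≤ x * 1 := by
        gcongr
        · exact hx.1
        · refine mul_le_one₀ hy.2 (mul_nonneg (by linarith [hz.2]) (by linarith [hw.2])) ?_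
          refine mul_le_one₀ (by linarith [hz.1]) (by linarith [hw.2]) (by linarith [hw.1])
      _ = x := mul_one x
  have c' : z * w * (1 - x) * (1 - y) ≤ z := by
    calc z * w * (1 - x) * (1 - y) = z * (w * ((1 - x) * (1 - y))) := by ring
      _ ≤ z * 1 := by
        gcongr
        · exact hz.1
        · refine mul_le_one₀ hw.2 (mul_nonneg (by linarith [hx.2]) (by linarith [hy.2])) ?_
          refine mul_le_one₀ (by linarith [hx.1]) (by linarith [hy.2]) (by linarith [hy.1])
      _ = z := mul_one z
  rw [abs_le]
  constructor <;> linarith [hx.1, hz.1]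

/-- The integrand of the collision operator. -/
def Fint (b : R3 × S2 → ℝ) (f : R3 → ℝ) (v : R3) (ω : S2) (vs : R3) : ℝ :=
  b (v - vs, ω) *
        (f (vPrime v vs ω) * f (vsPrime v vs ω) * (1 - f v) * (1 - f vs)
          - f v * f vs * (1 - f (vPrime v vs ω)) * (1 - f (vsPrime v vs ω)))

lemma Fint_le {b : R3 × S2 → ℝ} (hb0 : ∀ p, 0 ≤ b p) {f : R3 → ℝ} (hf : ∀ v, 0 ≤ f v ∧ f v ≤ 1)
    (v : R3) (ω : S2) (vs : R3) : ‖Fint b f v ω vs‖ₑ ≤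
      ENNReal.ofReal (b (v - vs, ω)) * (ENNReal.ofReal (f (vPrime v vs ω)) + ENNReal.ofReal (f v)) := by
  unfold Fint
  rw [← ENNReal.ofReal_add (hf _).1 (hf _).1, ← ENNReal.ofReal_mul (hb0 _), ← ofReal_norm,
    Real.norm_eq_abs, abs_mul, abs_of_nonneg (hb0 _)]
  refine ENNReal.ofReal_le_ofReal (mul_le_mul_of_nonneg_left ?_ (hb0 _))
  exact bracket_le (hf _) (hf _) (hf _) (hf _)

lemma Qcoll_le {b : R3 × S2 → ℝ} (hb0 : ∀ p, 0 ≤ b p) {f : R3 → ℝ} (hf : ∀ v, 0 ≤ f v ∧ f v ≤ 1)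
    (v : R3) : ‖Qcoll b f v‖ₑ ≤ Aop b (fun w => ENNReal.ofReal (f w)) v := by
  unfold Qcoll Aop
  refine (enorm_integral_le_lintegral_enorm _).trans (lintegral_mono fun ω => ?_)
  refine (enorm_integral_le_lintegral_enorm _).trans (lintegral_mono fun vs => ?_)
  exact Fint_le hb0 hf v ω vs

lemma Qcoll_meas {Y : Type*} [MeasurableSpace Y] {b : R3 × S2 → ℝ} (hb : Measurable b)
    {p : Y × R3 → ℝ} (hp : Measurable p) :
    Measurable (fun y : Y × R3 => Qcoll b (fun w => p (y.1, w)) y.2) := by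
  have h1 : Measurable fun q : ((Y × R3) × S2) × R3 => vPrime q.1.1.2 q.2 q.1.2 :=
    Measurable.vPrime' (by fun_prop) (by fun_prop) (by fun_prop)
  have h2 : Measurable fun q : ((Y × R3) × S2) × R3 => vsPrime q.1.1.2 q.2 q.1.2 :=
    Measurable.vsPrime' (by fun_prop) (by fun_prop) (by fun_prop)
  have h3 : Measurable fun q : ((Y × R3) × S2) × R3 =>
      Fint b (fun w => p (q.1.1.1, w)) q.1.1.2 q.1.2 q.2 := by
    unfold Fint
    fun_prop
  exact (h3.stronglyMeasurable.integral_prod_right.integral_prod_right).measurable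

lemma rearr_mp : MeasurePreserving (fun z : (R3 × S2) × R3 => (z.1.2, (z.1.1, z.2)))
    (((volume : Measure R3).prod sphMeasure).prod (volume : Measure R3))
    (sphMeasure.prod ((volume : Measure R3).prod (volume : Measure R3))) :=
  (measurePreserving_prodAssoc sphMeasure (volume : Measure R3) (volume : Measure R3)).comp
    ((Measure.measurePreserving_swap (μ := (volume : Measure R3)) (ν := sphMeasure)).prod
      (MeasurePreserving.id (volume : Measure R3)))

lemma rearr_emb : MeasurableEmbedding (fun z : (R3 × S2) × R3 => (z.1.2, (z.1.1, z.2))) := by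
  have : (fun z : (R3 × S2) × R3 => (z.1.2, (z.1.1, z.2))) =
    (⟨⟨fun z : (R3 × S2) × R3 => (z.1.2, (z.1.1, z.2)), fun z => ((z.2.1, z.1), z.2.2),
      fun p => rfl, fun p => rfl⟩,
      (by fun_prop : Measurable (fun z : (R3 × S2) × R3 => (z.1.2, (z.1.1, z.2)))),
      (by fun_prop : Measurable (fun z : S2 × R3 × R3 => ((z.2.1, z.1), z.2.2)))⟩ :
      ((R3 × S2) × R3) ≃ᵐ (S2 × R3 × R3)) := rfl
  rw [this]
  exact MeasurableEquiv.measurableEmbedding _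

lemma Fint_meas {b : R3 × S2 → ℝ} (hb : Measurable b) {f : R3 → ℝ} (hf : Measurable f) :
    Measurable (fun z : (R3 × S2) × R3 => Fint b f z.1.1 z.1.2 z.2) := by
  have h1 : Measurable fun q : (R3 × S2) × R3 => vPrime q.1.1 q.2 q.1.2 :=
    Measurable.vPrime' (by fun_prop) (by fun_prop) (by fun_prop)
  have h2 : Measurable fun q : (R3 × S2) × R3 => vsPrime q.1.1 q.2 q.1.2 :=
    Measurable.vsPrime' (by fun_prop) (by fun_prop) (by fun_prop)
  unfold Fint
  fun_prop

lemma int_Q_zero {b : R3 × S2 → ℝ} (hb : Measurable b) (hb0 : ∀ p, 0 ≤ b p) (hs : KSym b)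
    (hB : Bn b ≠ ∞) {f : R3 → ℝ} (hfm : Measurable f) (hf : ∀ v, 0 ≤ f v ∧ f v ≤ 1)
    (hfi : ∫⁻ v, ENNReal.ofReal (f v) ≠ ∞) : ∫ v, Qcoll b f v = 0 := by
  have hm := Fint_meas hb hfm
  have hI : Integrable (fun z : (R3 × S2) × R3 => Fint b f z.1.1 z.1.2 z.2)
      (((volume : Measure R3).prod sphMeasure).prod (volume : Measure R3)) := by
    refine ⟨hm.aestronglyMeasurable, ?_⟩
    unfold HasFiniteIntegral
    rw [lintegral_prod _ hm.enorm.aemeasurable, lintegral_prod]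
    swap
    · exact (Measurable.lintegral_prod_right' (f := fun z : (R3 × S2) × R3 => ‖Fint b f z.1.1 z.1.2 z.2‖ₑ) hm.enorm).aemeasurable
    calc _ ≤ ∫⁻ v, Aop b (fun w => ENNReal.ofReal (f w)) v := by
          unfold Aop
          refine lintegral_mono fun v => lintegral_mono fun ω => lintegral_mono fun vs => ?_
          exact Fint_le hb0 hf v ω vs
      _ < ∞ := by
          rw [lint_Aop hb hs (by fun_prop)]
          exact ENNReal.mul_lt_top (ENNReal.mul_lt_top (by simp) hB.lt_top) hfi.lt_top
  have hJ : Integrable (fun z : S2 × (R3 × R3) => Fint b f z.2.1 z.1 z.2.2)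
      (sphMeasure.prod ((volume : Measure R3).prod (volume : Measure R3))) :=
    (rearr_mp.integrable_comp_emb rearr_emb).1 hI
  have hK : Integrable (fun z : R3 × S2 => ∫ vs, Fint b f z.1 z.2 vs)
      ((volume : Measure R3).prod sphMeasure) := hI.integral_prod_left
  have e1 : ∫ v, Qcoll b f v = ∫ ω, ∫ v, ∫ vs, Fint b f v ω vs ∂volume ∂volume ∂sphMeasure :=
    integral_integral_swap (f := fun v ω => ∫ vs, Fint b f v ω vs) hK
  rw [e1]
  refine integral_eq_zero_of_ae ?_
  filter_upwards [hJ.prod_right_ae] with ω hω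
  have e2 : ∫ v, ∫ vs, Fint b f v ω vs =
    ∫ z, Fint b f z.1 ω z.2 ∂((volume : Measure R3).prod (volume : Measure R3)) :=
    (integral_prod _ hω).symm
  have e3 := (Tcoll_mp ω).integral_comp (Tcoll_emb ω) (fun z => Fint b f z.1 ω z.2)
  have e4 : ∀ z, Fint b f (Tcoll ω z).1 ω (Tcoll ω z).2 = - Fint b f z.1 ω z.2 := by
    intro z
    have hz1 : vPrime (vPrime z.1 z.2 ω) (vsPrime z.1 z.2 ω) ω = z.1 :=
      congrArg Prod.fst (Tcoll_invol ω z)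
    have hz2 : vsPrime (vPrime z.1 z.2 ω) (vsPrime z.1 z.2 ω) ω = z.2 :=
      congrArg Prod.snd (Tcoll_invol ω z)
    simp only [Fint, Tcoll, hz1, hz2, hs z.1 z.2 ω]
    ring
  simp_rw [e4] at e3
  rw [integral_neg] at e3
  rw [e2]
  simp only [Pi.zero_apply]
  linarith

lemma Qcoll_congr_ae {b : R3 × S2 → ℝ} {f g : R3 → ℝ} (h : f =ᵐ[volume] g) :
    ∀ᵐ v : R3, Qcoll b f v = Qcoll b g v := by
  have hq1 : Measure.QuasiMeasurePreserving
      (fun z : S2 × (R3 × R3) => (z.1, Tcoll z.1 z.2))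
      (sphMeasure.prod ((volume : Measure R3).prod (volume : Measure R3)))
      (sphMeasure.prod ((volume : Measure R3).prod (volume : Measure R3))) := by
    refine ((MeasurePreserving.id _).skew_product (g := fun s p => Tcoll s p)
      ?_ ?_).quasiMeasurePreserving
    · exact vPrime_meas.prodMk vsPrime_meas
    · exact Filter.Eventually.of_forall fun a => (Tcoll_mp a).map_eq
  have p1 : Measure.QuasiMeasurePreserving (fun z : S2 × (R3 × R3) => z.2.1)
      (sphMeasure.prod ((volume : Measure R3).prod (volume : Measure R3))) volume :=
    Measure.quasiMeasurePreserving_fst.comp Measure.quasiMeasurePreserving_snd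
  have p2 : Measure.QuasiMeasurePreserving (fun z : S2 × (R3 × R3) => z.2.2)
      (sphMeasure.prod ((volume : Measure R3).prod (volume : Measure R3))) volume :=
    Measure.quasiMeasurePreserving_snd.comp Measure.quasiMeasurePreserving_snd
  have r := rearr_mp.quasiMeasurePreserving
  have a1 := (p1.comp r).ae h
  have a2 := (p2.comp r).ae h
  have a3 := ((p1.comp hq1).comp r).ae h
  have a4 := ((p2.comp hq1).comp r).ae h
  have key : ∀ᵐ z ∂(((volume : Measure R3).prod sphMeasure).prod (volume : Measure R3)),
      Fint b f z.1.1 z.1.2 z.2 = Fint b g z.1.1 z.1.2 z.2 := by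
    filter_upwards [a1, a2, a3, a4] with z h1 h2 h3 h4
    simp only [Function.comp_def, Tcoll] at h1 h2 h3 h4
    simp only [Fint, h1, h2, h3, h4]
  filter_upwards [Measure.ae_ae_of_ae_prod (Measure.ae_ae_of_ae_prod key)] with v hv
  refine integral_congr_ae ?_
  filter_upwards [hv] with ω hω
  exact integral_congr_ae hω

/-- The collision term at time `s` and phase-space point `q`. -/
def Qg (b : R3 × S2 → ℝ) (g : ℝ × R3 × R3 → ℝ) (s : ℝ) (q : R3 × R3) : ℝ :=
  Qcoll b (fun w => g (s, q.1, w)) q.2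

lemma Qg_meas {b : R3 × S2 → ℝ} (hb : Measurable b) {g : ℝ × R3 × R3 → ℝ} (hg : Measurable g) :
    Measurable (fun z : ℝ × R3 × R3 => Qg b g z.1 z.2) := by
  have h := Qcoll_meas (Y := ℝ × R3) hb (p := fun z => g (z.1.1, z.1.2, z.2)) (by fun_prop)
  exact h.comp (g := fun z : (ℝ × R3) × R3 => Qcoll b (fun w => g (z.1.1, z.1.2, w)) z.2)
    (f := fun z : ℝ × R3 × R3 => ((z.1, z.2.1), z.2.2)) (by fun_prop)

lemma Qg_shift_meas {b : R3 × S2 → ℝ} (hb : Measurable b) {g : ℝ × R3 × R3 → ℝ}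
    (hg : Measurable g) :
    Measurable (fun z : ℝ × R3 × R3 => Qg b g z.1 (Sfree z.1 z.2)) := by
  have h : Measurable (fun z : ℝ × R3 × R3 => (z.1, Sfree z.1 z.2)) := by
    unfold Sfree; fun_prop
  exact (Qg_meas hb hg).comp h

lemma Qg_le {b : R3 × S2 → ℝ} (hb0 : ∀ p, 0 ≤ b p) {g : ℝ × R3 × R3 → ℝ}
    (hg : ∀ p, 0 ≤ g p ∧ g p ≤ 1) (s : ℝ) (q : R3 × R3) :
    ‖Qg b g s q‖ₑ ≤ Aop b (fun w => ENNReal.ofReal (g (s, q.1, w))) q.2 :=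
  Qcoll_le hb0 (fun _ => hg _) q.2

lemma Qg_le' {b : R3 × S2 → ℝ} (hb : Measurable b) (hb0 : ∀ p, 0 ≤ b p) {g : ℝ × R3 × R3 → ℝ}
    (hg : ∀ p, 0 ≤ g p ∧ g p ≤ 1) (s : ℝ) (q : R3 × R3) :
    ‖Qg b g s q‖ₑ ≤ 2 * Bn b :=
  (Qg_le hb0 hg s q).trans (Aop_le hb (fun v => by
    rw [← ENNReal.ofReal_one]; exact ENNReal.ofReal_le_ofReal (hg _).2) _)

lemma Qg_norm_le {b : R3 × S2 → ℝ} (hb : Measurable b) (hb0 : ∀ p, 0 ≤ b p) (hB : Bn b ≠ ∞)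
    {g : ℝ × R3 × R3 → ℝ}
    (hg : ∀ p, 0 ≤ g p ∧ g p ≤ 1) (s : ℝ) (q : R3 × R3) :
    ‖Qg b g s q‖ ≤ (2 * Bn b).toReal := by
  have := ENNReal.toReal_mono (by finiteness) (Qg_le' hb hb0 hg s q)
  simpa using this

lemma Qg_intervalIntegrable {b : R3 × S2 → ℝ} (hb : Measurable b) (hb0 : ∀ p, 0 ≤ b p)
    (hB : Bn b ≠ ∞) {g : ℝ × R3 × R3 → ℝ} (hgm : Measurable g)
    (hg : ∀ p, 0 ≤ g p ∧ g p ≤ 1) (q : R3 × R3) (t t' : ℝ) :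
    IntervalIntegrable (fun s => Qg b g s (Sfree s q)) volume t t' := by
  have hm : Measurable (fun s => Qg b g s (Sfree s q)) :=
    (Qg_shift_meas hb hgm).comp (measurable_id.prodMk measurable_const)
  refine (intervalIntegrable_const (c := (2 * Bn b).toReal)).mono_fun'
    hm.aestronglyMeasurable ?_
  exact Filter.Eventually.of_forall fun s => Qg_norm_le hb hb0 hB hg s _

lemma lint_pow_step (K : ℝ) (hK : 0 ≤ K) (N : ℕ) (t : ℝ) (ht : 0 ≤ t) :
    ∫⁻ s in Set.Ioc 0 t, ENNReal.ofReal K * ENNReal.ofReal ((K * s) ^ N / N.factorial)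
      = ENNReal.ofReal ((K * t) ^ (N + 1) / (N + 1).factorial) := by
  have h1 : ∫⁻ s in Set.Ioc 0 t, ENNReal.ofReal K * ENNReal.ofReal ((K * s) ^ N / N.factorial)
      = ∫⁻ s in Set.Ioc 0 t, ENNReal.ofReal (K * ((K * s) ^ N / N.factorial)) := by
    simp_rw [ENNReal.ofReal_mul hK]
  rw [h1, ← ofReal_integral_eq_lintegral_ofReal, ← intervalIntegral.integral_of_le ht]
  · congr 1
    have : ∀ s : ℝ, K * ((K * s) ^ N / N.factorial) = (K ^ (N + 1) / N.factorial) * s ^ N := by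
      intro s; rw [mul_pow, pow_succ]; ring
    simp_rw [this]
    rw [intervalIntegral.integral_const_mul, integral_pow, Nat.factorial_succ]
    have h2 : (N.factorial : ℝ) ≠ 0 := by positivity
    have h3 : (N : ℝ) + 1 ≠ 0 := by positivity
    push_cast
    field_simp
    ring
  · refine Continuous.integrableOn_Ioc ?_
    fun_prop
  · filter_upwards [ae_restrict_mem measurableSet_Ioc] with s hs
    have := hs.1.le
    simp only [Pi.zero_apply]
    positivity

lemma lint_exp_step (K : ℝ) (hK : 0 ≤ K) (t : ℝ) (ht : 0 ≤ t) :
    ∫⁻ s in Set.Ioc 0 t, ENNReal.ofReal K * ENNReal.ofReal (Real.exp (K * s))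
      = ENNReal.ofReal (Real.exp (K * t) - 1) := by
  have h1 : ∫⁻ s in Set.Ioc 0 t, ENNReal.ofReal K * ENNReal.ofReal (Real.exp (K * s))
      = ∫⁻ s in Set.Ioc 0 t, ENNReal.ofReal (K * Real.exp (K * s)) := by
    simp_rw [ENNReal.ofReal_mul hK]
  rw [h1, ← ofReal_integral_eq_lintegral_ofReal, ← intervalIntegral.integral_of_le ht]
  · congr 1
    rw [intervalIntegral.integral_eq_sub_of_hasDerivAt (f := fun s => Real.exp (K * s))]
    · simp
    · intro x _
      have := ((hasDerivAt_id x).const_mul K).exp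
      simpa [mul_comm] using this
    · exact (by fun_prop : Continuous fun s => K * Real.exp (K * s)).intervalIntegrable _ _
  · refine Continuous.integrableOn_Ioc ?_
    fun_prop
  · refine Filter.Eventually.of_forall fun s => ?_
    simp only [Pi.zero_apply]
    positivity

lemma lint_Aop_phase {b : R3 × S2 → ℝ} (hb : Measurable b) (hs : KSym b)
    {p : R3 × R3 → ℝ≥0∞} (hp : Measurable p) :
    ∫⁻ q : R3 × R3, Aop b (fun w => p (q.1, w)) q.2 = 2 * Bn b * ∫⁻ q, p q := by
  rw [Measure.volume_eq_prod, lintegral_prod _ (Aop_meas hb hp).aemeasurable,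
    lintegral_prod _ hp.aemeasurable, ← lintegral_const_mul _ hp.lintegral_prod_right']
  refine lintegral_congr fun x => ?_
  exact lint_Aop hb hs (p := fun w => p (x, w)) (by fun_prop)

lemma trunc_bound {b : R3 × S2 → ℝ} (hb : Measurable b) (hb0 : ∀ p, 0 ≤ b p) (hs : KSym b)
    (hB : Bn b ≠ ∞) {g : ℝ × R3 × R3 → ℝ} (hgm : Measurable g)
    (hg : ∀ p, 0 ≤ g p ∧ g p ≤ 1) {f₀ : R3 × R3 → ℝ} (hf₀ : Measurable f₀)
    (hmild : ∀ᵐ q : R3 × R3, ∀ t : ℝ, 0 ≤ t →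
      g (t, Sfree t q) = f₀ q + ∫ s in (0 : ℝ)..t, Qg b g s (Sfree s q)) (N : ℕ) :
    ∀ t : ℝ, 0 ≤ t → ∫⁻ q : R3 × R3, (ENNReal.ofReal (g (t, q)) -
        ENNReal.ofReal (((2 * Bn b).toReal * t) ^ N / N.factorial))
      ≤ ENNReal.ofReal (Real.exp ((2 * Bn b).toReal * t)) * ∫⁻ q, ENNReal.ofReal (f₀ q) := by
  set K := (2 * Bn b).toReal with hKdef
  have hK0 : 0 ≤ K := ENNReal.toReal_nonneg
  have hKe : ENNReal.ofReal K = 2 * Bn b := ENNReal.ofReal_toReal (by finiteness)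
  induction N with
  | zero =>
    intro t ht
    have : ∀ q : R3 × R3, ENNReal.ofReal (g (t, q)) -
        ENNReal.ofReal ((K * t) ^ 0 / (Nat.factorial 0)) = 0 := by
      intro q
      apply tsub_eq_zero_of_le
      apply ENNReal.ofReal_le_ofReal
      simpa using (hg _).2
    simp_rw [this]
    simp
  | succ N ih =>
    intro t ht
    set c : ℝ → ℝ≥0∞ := fun s => ENNReal.ofReal ((K * s) ^ N / N.factorial) with hc
    have hcm : Measurable c := by fun_prop
    set D : ℝ → R3 × R3 → ℝ≥0∞ := fun s q =>
      Aop b (fun w => ENNReal.ofReal (g (s, q.1, w)) - c s) q.2 with hD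
    have hDm : Measurable (fun z : ℝ × R3 × R3 => D z.1 z.2) := by
      have h := Aop_meas (Y := ℝ × R3) hb
        (p := fun z => ENNReal.ofReal (g (z.1.1, z.1.2, z.2)) - c z.1.1) (by fun_prop)
      exact h.comp (g := fun z : (ℝ × R3) × R3 => Aop b (fun w => ENNReal.ofReal (g (z.1.1, z.1.2, w)) - c z.1.1) z.2)
        (f := fun z : ℝ × R3 × R3 => ((z.1, z.2.1), z.2.2)) (by fun_prop)
    have hST : Measurable (fun z : ℝ × R3 × R3 => (z.1, Sfree z.1 z.2)) := by
      unfold Sfree; fun_prop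
    have hDSm : Measurable (fun z : ℝ × R3 × R3 => D z.1 (Sfree z.1 z.2)) := hDm.comp hST
    have hpt : ∀ᵐ q : R3 × R3, ENNReal.ofReal (g (t, Sfree t q)) -
        ENNReal.ofReal ((K * t) ^ (N + 1) / (N + 1).factorial)
        ≤ ENNReal.ofReal (f₀ q) + ∫⁻ s in Set.Ioc 0 t, D s (Sfree s q) := by
      filter_upwards [hmild] with q hq
      rw [hq t ht, tsub_le_iff_right, ← lint_pow_step K hK0 N t ht, add_assoc,
        ← lintegral_add_right _ (by fun_prop)]
      refine ENNReal.ofReal_add_le.trans ?_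
      gcongr
      refine (Real.ofReal_le_enorm _).trans ?_
      rw [intervalIntegral.integral_of_le ht]
      refine (enorm_integral_le_lintegral_enorm _).trans (lintegral_mono fun s => ?_)
      refine (Qg_le hb0 hg s _).trans ?_
      rw [hKe]
      exact Aop_trunc hb _ (c s) _
    calc _ = ∫⁻ q : R3 × R3, (ENNReal.ofReal (g (t, Sfree t q)) -
          ENNReal.ofReal ((K * t) ^ (N + 1) / (N + 1).factorial)) := by
          exact ((Sfree_mp t).lintegral_comp (f := fun q => ENNReal.ofReal (g (t, q)) -
            ENNReal.ofReal ((K * t) ^ (N + 1) / (N + 1).factorial)) (by fun_prop)).symm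
      _ ≤ ∫⁻ q : R3 × R3, (ENNReal.ofReal (f₀ q) + ∫⁻ s in Set.Ioc 0 t, D s (Sfree s q)) :=
          lintegral_mono_ae hpt
      _ = (∫⁻ q : R3 × R3, ENNReal.ofReal (f₀ q)) +
          ∫⁻ s in Set.Ioc 0 t, ∫⁻ q, D s (Sfree s q) := by
          rw [lintegral_add_left (by fun_prop), lintegral_lintegral_swap]
          exact (hDSm.comp measurable_swap).aemeasurable
      _ ≤ (∫⁻ q : R3 × R3, ENNReal.ofReal (f₀ q)) +
          ∫⁻ s in Set.Ioc 0 t, ENNReal.ofReal K * ENNReal.ofReal (Real.exp (K * s)) *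
            ∫⁻ q, ENNReal.ofReal (f₀ q) := by
          gcongr 1
          refine setLIntegral_mono' measurableSet_Ioc fun s hs' => ?_
          rw [(Sfree_mp s).lintegral_comp (f := fun q => D s q)
            (hDm.comp (measurable_const.prodMk measurable_id)), hKe, mul_assoc]
          have := lint_Aop_phase hb hs (p := fun q => ENNReal.ofReal (g (s, q)) - c s) (by fun_prop)
          refine this.le.trans ?_
          gcongr
          exact ih s hs'.1.le
      _ = _ := by
          rw [lintegral_mul_const _ (by fun_prop), lint_exp_step K hK0 t ht]
          nth_rw 1 [← one_mul (∫⁻ q : R3 × R3, ENNReal.ofReal (f₀ q))]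
          rw [← add_mul, ← ENNReal.ofReal_one, ← ENNReal.ofReal_add (by norm_num)]
          · congr 2; ring
          · have := Real.one_le_exp (mul_nonneg hK0 ht); linarith

lemma mass_bound {b : R3 × S2 → ℝ} (hb : Measurable b) (hb0 : ∀ p, 0 ≤ b p) (hs : KSym b)
    (hB : Bn b ≠ ∞) {g : ℝ × R3 × R3 → ℝ} (hgm : Measurable g)
    (hg : ∀ p, 0 ≤ g p ∧ g p ≤ 1) {f₀ : R3 × R3 → ℝ} (hf₀ : Measurable f₀)
    (hmild : ∀ᵐ q : R3 × R3, ∀ t : ℝ, 0 ≤ t →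
      g (t, Sfree t q) = f₀ q + ∫ s in (0 : ℝ)..t, Qg b g s (Sfree s q)) 
    (t : ℝ) (ht : 0 ≤ t) : ∫⁻ q : R3 × R3, ENNReal.ofReal (g (t, q))
      ≤ ENNReal.ofReal (Real.exp ((2 * Bn b).toReal * t)) * ∫⁻ q, ENNReal.ofReal (f₀ q) := by
  have h0 := FloorSemiring.tendsto_pow_div_factorial_atTop ((2 * Bn b).toReal * t)
  have h1 := ENNReal.tendsto_ofReal h0
  rw [ENNReal.ofReal_zero] at h1
  have h2 : ∀ q : R3 × R3, Filter.liminf (fun N : ℕ => ENNReal.ofReal (g (t, q)) -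
        ENNReal.ofReal (((2 * Bn b).toReal * t) ^ N / N.factorial)) Filter.atTop =
        ENNReal.ofReal (g (t, q)) := by
    intro q
    have := ENNReal.Tendsto.sub (tendsto_const_nhds (x := ENNReal.ofReal (g (t, q)))) h1
      (Or.inl ENNReal.ofReal_ne_top)
    rw [tsub_zero] at this
    exact this.liminf_eq
  calc _ = ∫⁻ q : R3 × R3, Filter.liminf (fun N : ℕ => ENNReal.ofReal (g (t, q)) -
        ENNReal.ofReal (((2 * Bn b).toReal * t) ^ N / N.factorial)) Filter.atTop := by
        simp_rw [h2]
    _ ≤ _ := lintegral_liminf_le (fun N => by fun_prop)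
    _ ≤ Filter.liminf (fun N : ℕ => ENNReal.ofReal (Real.exp ((2 * Bn b).toReal * t)) * ∫⁻ q, ENNReal.ofReal (f₀ q)) Filter.atTop := by
        refine Filter.liminf_le_liminf (Filter.Eventually.of_forall fun N => ?_)
        exact trunc_bound hb hb0 hs hB hgm hg hf₀ hmild N t ht
    _ = _ := by simp

lemma g_integrable {b : R3 × S2 → ℝ} (hb : Measurable b) (hb0 : ∀ p, 0 ≤ b p) (hs : KSym b)
    (hB : Bn b ≠ ∞) {g : ℝ × R3 × R3 → ℝ} (hgm : Measurable g)
    (hg : ∀ p, 0 ≤ g p ∧ g p ≤ 1) {f₀ : R3 × R3 → ℝ} (hf₀ : Measurable f₀)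
    (hI0 : ∫⁻ q, ENNReal.ofReal (f₀ q) ≠ ∞)
    (hmild : ∀ᵐ q : R3 × R3, ∀ t : ℝ, 0 ≤ t →
      g (t, Sfree t q) = f₀ q + ∫ s in (0 : ℝ)..t, Qg b g s (Sfree s q))
    (t : ℝ) (ht : 0 ≤ t) : Integrable (fun q : R3 × R3 => g (t, q)) := by
  refine ⟨(by fun_prop : Measurable fun q : R3 × R3 => g (t, q)).aestronglyMeasurable, ?_⟩
  rw [hasFiniteIntegral_iff_ofReal (Filter.Eventually.of_forall fun q => (hg _).1)]
  exact (mass_bound hb hb0 hs hB hgm hg hf₀ hmild t ht).trans_lt (by finiteness)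

lemma Q_lint {b : R3 × S2 → ℝ} (hb : Measurable b) (hb0 : ∀ p, 0 ≤ b p) (hs : KSym b)
    (hB : Bn b ≠ ∞) {g : ℝ × R3 × R3 → ℝ} (hgm : Measurable g)
    (hg : ∀ p, 0 ≤ g p ∧ g p ≤ 1) {f₀ : R3 × R3 → ℝ} (hf₀ : Measurable f₀)
    (hmild : ∀ᵐ q : R3 × R3, ∀ t : ℝ, 0 ≤ t →
      g (t, Sfree t q) = f₀ q + ∫ s in (0 : ℝ)..t, Qg b g s (Sfree s q))
    (T s : ℝ) (h0 : 0 ≤ s) (hT : s ≤ T) :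
    ∫⁻ q : R3 × R3, ‖Qg b g s q‖ₑ ≤ 2 * Bn b *
      (ENNReal.ofReal (Real.exp ((2 * Bn b).toReal * T)) * ∫⁻ q, ENNReal.ofReal (f₀ q)) := by
  refine (lintegral_mono fun q => Qg_le hb0 hg s q).trans ?_
  have := lint_Aop_phase hb hs (p := fun q => ENNReal.ofReal (g (s, q))) (by fun_prop)
  refine this.le.trans ?_
  gcongr
  refine (mass_bound hb hb0 hs hB hgm hg hf₀ hmild s h0).trans ?_
  gcongr

lemma Q_lint_shift {b : R3 × S2 → ℝ} (hb : Measurable b) (hb0 : ∀ p, 0 ≤ b p) (hs : KSym b)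
    (hB : Bn b ≠ ∞) {g : ℝ × R3 × R3 → ℝ} (hgm : Measurable g)
    (hg : ∀ p, 0 ≤ g p ∧ g p ≤ 1) {f₀ : R3 × R3 → ℝ} (hf₀ : Measurable f₀)
    (hmild : ∀ᵐ q : R3 × R3, ∀ t : ℝ, 0 ≤ t →
      g (t, Sfree t q) = f₀ q + ∫ s in (0 : ℝ)..t, Qg b g s (Sfree s q))
    (T s : ℝ) (h0 : 0 ≤ s) (hT : s ≤ T) :
    ∫⁻ q : R3 × R3, ‖Qg b g s (Sfree s q)‖ₑ ≤ 2 * Bn b *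
      (ENNReal.ofReal (Real.exp ((2 * Bn b).toReal * T)) * ∫⁻ q, ENNReal.ofReal (f₀ q)) := by
  have hm : Measurable (fun q => Qg b g s q) :=
    (Qg_meas hb hgm).comp (measurable_const.prodMk measurable_id)
  rw [(Sfree_mp s).lintegral_comp (f := fun q => ‖Qg b g s q‖ₑ) hm.enorm]
  exact Q_lint hb hb0 hs hB hgm hg hf₀ hmild T s h0 hT

lemma Q_int_phase_zero {b : R3 × S2 → ℝ} (hb : Measurable b) (hb0 : ∀ p, 0 ≤ b p) (hs : KSym b)
    (hB : Bn b ≠ ∞) {g : ℝ × R3 × R3 → ℝ} (hgm : Measurable g)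
    (hg : ∀ p, 0 ≤ g p ∧ g p ≤ 1) {f₀ : R3 × R3 → ℝ} (hf₀ : Measurable f₀)
    (hI0 : ∫⁻ q, ENNReal.ofReal (f₀ q) ≠ ∞)
    (hmild : ∀ᵐ q : R3 × R3, ∀ t : ℝ, 0 ≤ t →
      g (t, Sfree t q) = f₀ q + ∫ s in (0 : ℝ)..t, Qg b g s (Sfree s q))
    (s : ℝ) (h0 : 0 ≤ s) : ∫ q : R3 × R3, Qg b g s q = 0 := by
  have hm : Measurable (fun q => Qg b g s q) :=
    (Qg_meas hb hgm).comp (measurable_const.prodMk measurable_id)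
  have hQi : Integrable (fun q : R3 × R3 => Qg b g s q) :=
    ⟨hm.aestronglyMeasurable,
      (Q_lint hb hb0 hs hB hgm hg hf₀ hmild s s h0 le_rfl).trans_lt (by finiteness)⟩
  have hgi := g_integrable hb hb0 hs hB hgm hg hf₀ hI0 hmild s h0
  rw [Measure.volume_eq_prod] at hQi hgi ⊢
  rw [integral_prod _ hQi]
  refine integral_eq_zero_of_ae ?_
  filter_upwards [hgi.prod_right_ae] with x hx
  exact int_Q_zero hb hb0 hs hB (f := fun w => g (s, x, w)) (by fun_prop) (fun _ => hg _)
    hx.lintegral_lt_top.ne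

lemma g_mass {b : R3 × S2 → ℝ} (hb : Measurable b) (hb0 : ∀ p, 0 ≤ b p) (hs : KSym b)
    (hB : Bn b ≠ ∞) {g : ℝ × R3 × R3 → ℝ} (hgm : Measurable g)
    (hg : ∀ p, 0 ≤ g p ∧ g p ≤ 1) {f₀ : R3 × R3 → ℝ} (hf₀ : Measurable f₀)
    (hf₀i : Integrable f₀)
    (hmild : ∀ᵐ q : R3 × R3, ∀ t : ℝ, 0 ≤ t →
      g (t, Sfree t q) = f₀ q + ∫ s in (0 : ℝ)..t, Qg b g s (Sfree s q))
    (t : ℝ) (ht : 0 ≤ t) : ∫ q : R3 × R3, g (t, q) = ∫ q, f₀ q := by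
  have hI0 : ∫⁻ q, ENNReal.ofReal (f₀ q) ≠ ∞ := hf₀i.lintegral_lt_top.ne
  have hm := Qg_shift_meas hb hgm
  have hP : Integrable (fun z : ℝ × R3 × R3 => Qg b g z.1 (Sfree z.1 z.2))
      (((volume : Measure ℝ).restrict (Set.Ioc 0 t)).prod (volume : Measure (R3 × R3))) := by
    refine ⟨hm.aestronglyMeasurable, ?_⟩
    unfold HasFiniteIntegral
    rw [lintegral_prod _ hm.enorm.aemeasurable]
    refine (setLIntegral_mono' measurableSet_Ioc fun s hs' =>
      Q_lint_shift hb hb0 hs hB hgm hg hf₀ hmild t s hs'.1.le hs'.2).trans_lt ?_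
    rw [setLIntegral_const, Real.volume_Ioc]
    finiteness
  have e1 : ∫ q : R3 × R3, g (t, q) = ∫ q : R3 × R3, g (t, Sfree t q) :=
    ((Sfree_mp t).integral_comp (Sfree_emb t) (fun q => g (t, q))).symm
  have e2 : ∫ q : R3 × R3, g (t, Sfree t q) =
      ∫ q : R3 × R3, (f₀ q + ∫ s in Set.Ioc 0 t, Qg b g s (Sfree s q)) := by
    refine integral_congr_ae ?_
    filter_upwards [hmild] with q hq
    rw [hq t ht, intervalIntegral.integral_of_le ht]
  rw [e1, e2, integral_add hf₀i hP.integral_prod_right]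
  have e3 : ∫ q : R3 × R3, ∫ s in Set.Ioc 0 t, Qg b g s (Sfree s q) =
      ∫ s in Set.Ioc 0 t, ∫ q : R3 × R3, Qg b g s (Sfree s q) :=
    (integral_integral_swap hP).symm
  rw [e3]
  have e4 : ∫ s in Set.Ioc 0 t, ∫ q : R3 × R3, Qg b g s (Sfree s q) = 0 := by
    refine integral_eq_zero_of_ae ?_
    filter_upwards [ae_restrict_mem measurableSet_Ioc] with s hs'
    rw [(Sfree_mp s).integral_comp (Sfree_emb s) (fun q => Qg b g s q)]
    exact Q_int_phase_zero hb hb0 hs hB hgm hg hf₀ hI0 hmild s hs'.1.le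
  rw [e4, add_zero]

/-- Continuity of free transport in `L¹`. -/
lemma Sfree_cont {h : R3 × R3 → ℝ} (hi : Integrable h) (t : ℝ) :
    Filter.Tendsto (fun s => ∫⁻ q : R3 × R3, ‖h (Sfree t q) - h (Sfree s q)‖ₑ)
      (nhds t) (nhds 0) := by
  have hL : MemLp h 1 (volume : Measure (R3 × R3)) := memLp_one_iff_integrable.2 hi
  let S : C(ℝ, C(R3 × R3, R3 × R3)) := ContinuousMap.curry
    ⟨fun z : ℝ × (R3 × R3) => Sfree z.1 z.2, by unfold Sfree; fun_prop⟩
  have hS : ∀ s, MeasurePreserving (S s) (volume : Measure (R3 × R3)) volume := fun s => Sfree_mp s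
  have key := Filter.Tendsto.compMeasurePreservingLp (l := nhds t) (f := fun _ => hL.toLp h)
    (g := S) tendsto_const_nhds (S.continuous.tendsto t) hS (hS t) (by simp)
  rw [tendsto_iff_edist_tendsto_0] at key
  refine key.congr fun s => ?_
  rw [Lp.toLp_compMeasurePreserving, Lp.toLp_compMeasurePreserving, edist_comm,
    Lp.edist_toLp_toLp, eLpNorm_one_eq_lintegral_enorm]
  rfl

lemma g_cont {b : R3 × S2 → ℝ} (hb : Measurable b) (hb0 : ∀ p, 0 ≤ b p) (hs : KSym b)
    (hB : Bn b ≠ ∞) {g : ℝ × R3 × R3 → ℝ} (hgm : Measurable g)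
    (hg : ∀ p, 0 ≤ g p ∧ g p ≤ 1) {f₀ : R3 × R3 → ℝ} (hf₀ : Measurable f₀)
    (hI0 : ∫⁻ q, ENNReal.ofReal (f₀ q) ≠ ∞)
    (hmild : ∀ᵐ q : R3 × R3, ∀ t : ℝ, 0 ≤ t →
      g (t, Sfree t q) = f₀ q + ∫ s in (0 : ℝ)..t, Qg b g s (Sfree s q))
    (t : ℝ) (ht : 0 ≤ t) :
    Filter.Tendsto (fun s => ∫⁻ q : R3 × R3, ‖g (s, q) - g (t, q)‖ₑ)
      (nhdsWithin t (Set.Ici 0)) (nhds 0) := by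
  have hgi := g_integrable hb hb0 hs hB hgm hg hf₀ hI0 hmild t ht
  have c2 := (Sfree_cont hgi t).mono_left (nhdsWithin_le_nhds (s := Set.Ici 0))
  set C : ℝ≥0∞ := 2 * Bn b *
      (ENNReal.ofReal (Real.exp ((2 * Bn b).toReal * (t + 1))) * ∫⁻ q, ENNReal.ofReal (f₀ q))
    with hC
  have hCtop : C ≠ ∞ := by rw [hC]; finiteness
  have c1 : Filter.Tendsto (fun s => C * ENNReal.ofReal |s - t|)
      (nhdsWithin t (Set.Ici 0)) (nhds 0) := by
    have h1 : Filter.Tendsto (fun s : ℝ => ENNReal.ofReal |s - t|) (nhds t) (nhds 0) := by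
      have : Continuous (fun s : ℝ => ENNReal.ofReal |s - t|) :=
        ENNReal.continuous_ofReal.comp (by fun_prop)
      simpa using this.tendsto t
    have := ENNReal.Tendsto.const_mul h1 (Or.inr hCtop)
    rw [mul_zero] at this
    exact this.mono_left nhdsWithin_le_nhds
  have c3 := c1.add c2
  rw [add_zero] at c3
  refine tendsto_of_tendsto_of_tendsto_of_le_of_le' tendsto_const_nhds c3
    (Filter.Eventually.of_forall fun _ => bot_le) ?_
  have hnear : ∀ᶠ s in nhdsWithin t (Set.Ici 0), s < t + 1 :=
    (eventually_lt_nhds (by linarith)).filter_mono nhdsWithin_le_nhds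
  filter_upwards [self_mem_nhdsWithin, hnear] with s hs0 hs1
  rw [Set.mem_Ici] at hs0
  have hSs := Sfree_meas s
  have hSt := Sfree_meas t
  rw [← (Sfree_mp s).lintegral_comp (f := fun q => ‖g (s, q) - g (t, q)‖ₑ) (by fun_prop)]
  calc _ ≤ ∫⁻ q : R3 × R3, (‖g (s, Sfree s q) - g (t, Sfree t q)‖ₑ +
        ‖g (t, Sfree t q) - g (t, Sfree s q)‖ₑ) := by
        refine lintegral_mono fun q => ?_
        refine le_trans (le_of_eq ?_) (enorm_add_le _ _)
        congr 1; ring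
    _ = (∫⁻ q : R3 × R3, ‖g (s, Sfree s q) - g (t, Sfree t q)‖ₑ) +
        ∫⁻ q : R3 × R3, ‖g (t, Sfree t q) - g (t, Sfree s q)‖ₑ :=
        lintegral_add_left (by fun_prop) _
    _ ≤ _ := by
        gcongr ?_ + _
        have hm := Qg_shift_meas hb hgm
        calc _ ≤ ∫⁻ q : R3 × R3, ∫⁻ r in Set.uIoc t s, ‖Qg b g r (Sfree r q)‖ₑ := by
              refine lintegral_mono_ae ?_
              filter_upwards [hmild] with q hq
              rw [hq s hs0, hq t ht, add_sub_add_left_eq_sub,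
                intervalIntegral.integral_interval_sub_left
                  (Qg_intervalIntegrable hb hb0 hB hgm hg q _ _)
                  (Qg_intervalIntegrable hb hb0 hB hgm hg q _ _)]
              rw [← ofReal_norm, intervalIntegral.norm_intervalIntegral_eq, ofReal_norm]
              exact enorm_integral_le_lintegral_enorm _
          _ = ∫⁻ r in Set.uIoc t s, ∫⁻ q : R3 × R3, ‖Qg b g r (Sfree r q)‖ₑ := by
              rw [lintegral_lintegral_swap]
              exact (hm.enorm.comp measurable_swap).aemeasurable
          _ ≤ ∫⁻ r in Set.uIoc t s, C := by
              refine setLIntegral_mono' measurableSet_uIoc fun r hr => ?_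
              rw [Set.uIoc, Set.mem_Ioc] at hr
              refine Q_lint_shift hb hb0 hs hB hgm hg hf₀ hmild (t + 1) r ?_ ?_
              · exact (le_min ht hs0).trans hr.1.le
              · exact hr.2.trans (max_le (by linarith) hs1.le)
          _ = C * ENNReal.ofReal |s - t| := by
              rw [setLIntegral_const, Real.volume_uIoc]

lemma reduce_to_g {b : R3 × S2 → ℝ} (hb : Measurable b) (hb0 : ∀ p, 0 ≤ b p)
    (hB : Bn b ≠ ∞) {f : ℝ × R3 × R3 → ℝ} (hfm : Measurable f)
    (hf_bd : ∀ᵐ p ∂(volume : Measure (ℝ × R3 × R3)).restrict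
        (Set.Ici (0 : ℝ) ×ˢ (Set.univ : Set (R3 × R3))), 0 ≤ f p ∧ f p ≤ 1)
    {f₀ : R3 × R3 → ℝ} (hmild : IsMildSolution b f₀ f) :
    ∃ g : ℝ × R3 × R3 → ℝ, Measurable g ∧ (∀ p, 0 ≤ g p ∧ g p ≤ 1) ∧
      (∀ᵐ q : R3 × R3, ∀ t : ℝ, 0 ≤ t →
        g (t, Sfree t q) = f₀ q + ∫ s in (0 : ℝ)..t, Qg b g s (Sfree s q)) ∧
      (∀ t : ℝ, 0 ≤ t → ∀ᵐ q : R3 × R3, f (t, q) = g (t, q)) := by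
  set g : ℝ × R3 × R3 → ℝ := fun p => max 0 (min 1 (f p)) with hgdef
  have hgm : Measurable g := by fun_prop
  have hg : ∀ p, 0 ≤ g p ∧ g p ≤ 1 := fun p =>
    ⟨le_max_left _ _, max_le zero_le_one (min_le_left _ _)⟩
  rw [Measure.volume_eq_prod, ← Measure.prod_restrict, Measure.restrict_univ] at hf_bd
  have hfg : ∀ᵐ p ∂((volume : Measure ℝ).restrict (Set.Ici 0)).prod (volume : Measure (R3 × R3)),
      f p = g p := by
    filter_upwards [hf_bd] with p hp
    rw [hgdef]
    simp only
    rw [min_eq_right hp.2, max_eq_right hp.1]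
  have hQQ : ∀ᵐ p ∂((volume : Measure ℝ).restrict (Set.Ici 0)).prod (volume : Measure (R3 × R3)),
      Qg b f p.1 p.2 = Qg b g p.1 p.2 := by
    rw [Measure.ae_prod_iff_ae_ae (measurableSet_eq_fun (Qg_meas hb hfm) (Qg_meas hb hgm))]
    filter_upwards [Measure.ae_ae_of_ae_prod hfg] with s hs
    have hms : Measurable fun q => Qg b f s q :=
      (Qg_meas hb hfm).comp (measurable_const.prodMk measurable_id)
    have hms' : Measurable fun q => Qg b g s q :=
      (Qg_meas hb hgm).comp (measurable_const.prodMk measurable_id)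
    rw [Measure.volume_eq_prod] at hs ⊢
    rw [Measure.ae_prod_iff_ae_ae (measurableSet_eq_fun hms hms')]
    filter_upwards [Measure.ae_ae_of_ae_prod hs] with x hx
    exact Qcoll_congr_ae hx
  have hST := (SST_mp (Set.Ici 0)).quasiMeasurePreserving
  have hm1 : Measurable (fun z : ℝ × R3 × R3 => (z.1, Sfree z.1 z.2)) := hST.measurable
  have A1 : ∀ᵐ q : R3 × R3, ∀ᵐ s ∂((volume : Measure ℝ).restrict (Set.Ici 0)),
      f (s, Sfree s q) = g (s, Sfree s q) := by
    refine (Measure.ae_ae_comm ?_).1 (Measure.ae_ae_of_ae_prod (hST.ae hfg))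
    exact measurableSet_eq_fun (hfm.comp hm1) (hgm.comp hm1)
  have A2 : ∀ᵐ q : R3 × R3, ∀ᵐ s ∂((volume : Measure ℝ).restrict (Set.Ici 0)),
      Qg b f s (Sfree s q) = Qg b g s (Sfree s q) := by
    refine (Measure.ae_ae_comm ?_).1 (Measure.ae_ae_of_ae_prod (hST.ae hQQ))
    exact measurableSet_eq_fun (Qg_shift_meas hb hfm) (Qg_shift_meas hb hgm)
  have main : ∀ᵐ q : R3 × R3, ∀ t : ℝ, 0 ≤ t → f (t, Sfree t q) = g (t, Sfree t q) ∧
      f (t, Sfree t q) = f₀ q + ∫ s in (0 : ℝ)..t, Qg b g s (Sfree s q) := by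
    filter_upwards [A1, A2, hmild] with q h1 h2 h3
    set h : ℝ → ℝ := fun t => f₀ q + ∫ s in (0 : ℝ)..t, Qg b g s (Sfree s q) with hh
    have hcont : Continuous h := continuous_const.add
      (intervalIntegral.continuous_primitive
        (fun a c => Qg_intervalIntegrable hb hb0 hB hgm hg q a c) 0)
    have hfh : ∀ t : ℝ, 0 ≤ t → f (t, Sfree t q) = h t := by
      intro t ht
      refine (h3 t ht).trans ?_
      rw [hh]
      simp only
      congr 1
      refine intervalIntegral.integral_congr_ae ?_
      rw [ae_restrict_iff' measurableSet_Ici] at h2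
      filter_upwards [h2] with s hs hst
      rw [Set.uIoc_of_le ht] at hst
      exact hs hst.1.le
    have heq : Set.EqOn h (fun t => max 0 (min 1 (h t))) (Set.Ici 0) := by
      refine Measure.eqOn_of_ae_eq (μ := volume) ?_ hcont.continuousOn
        (by fun_prop) (by simp)
      filter_upwards [h1, ae_restrict_mem measurableSet_Ici] with s hs hs0
      rw [← hfh s hs0]
      exact hs
    intro t ht
    refine ⟨?_, hfh t ht⟩
    have := heq (Set.mem_Ici.2 ht)
    simp only at this
    rw [← hfh t ht] at this
    exact this
  refine ⟨g, hgm, hg, ?_, ?_⟩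
  · filter_upwards [main] with q hq t ht
    rw [← (hq t ht).1, (hq t ht).2]
  · intro t ht
    have h1 : ∀ᵐ q : R3 × R3, f (t, Sfree t q) = g (t, Sfree t q) := by
      filter_upwards [main] with q hq using (hq t ht).1
    have h2 := (Sfree_mp (-t)).quasiMeasurePreserving.ae h1
    filter_upwards [h2] with q hq
    have : Sfree t (Sfree (-t) q) = q := by simp [Sfree]
    rwa [this] at hq

/-- Conservation of the total mass: for an integrable collision kernel satisfying the
symmetry assumption `b(w,ω) = q(|w|,|w·ω|)` and an integrable initial datum `0 ≤ f₀ ≤ 1`,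
the mild solution `f` with `0 ≤ f ≤ 1` a.e. belongs to `C⁰([0,∞); L¹(ℝ³×ℝ³))` and
`∫∫ f(t,x,v) dx dv = ∫∫ f₀(x,v) dx dv` for all `t ≥ 0`. -/
theorem mild_solution_mass_conservation
    (b : R3 × S2 → ℝ) (hb_meas : Measurable b) (hb_nonneg : ∀ p, 0 ≤ b p)
    (hb_int : Integrable b ((volume : Measure R3).prod sphMeasure))
    (hb_sym : ∃ q : ℝ × ℝ → ℝ, Measurable q ∧
      ∀ (w : R3) (ω : S2), b (w, ω) = q (‖w‖, |⟪w, (ω : R3)⟫|))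
    (f₀ : R3 × R3 → ℝ) (hf₀_meas : Measurable f₀)
    (hf₀_bd : ∀ᵐ q : R3 × R3 ∂(volume : Measure (R3 × R3)), 0 ≤ f₀ q ∧ f₀ q ≤ 1)
    (hf₀_int : Integrable f₀ (volume : Measure (R3 × R3)))
    (f : ℝ × R3 × R3 → ℝ) (hf_meas : Measurable f)
    (hf_bd : ∀ᵐ p ∂(volume : Measure (ℝ × R3 × R3)).restrict
        (Set.Ici (0 : ℝ) ×ˢ (Set.univ : Set (R3 × R3))), 0 ≤ f p ∧ f p ≤ 1)
    (hf_mild : IsMildSolution b f₀ f) :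
    (∀ t : ℝ, 0 ≤ t → Integrable (fun q : R3 × R3 => f (t, q.1, q.2))
        (volume : Measure (R3 × R3))) ∧
    (∀ t : ℝ, 0 ≤ t →
      Filter.Tendsto
        (fun s => ∫ q : R3 × R3, |f (s, q.1, q.2) - f (t, q.1, q.2)|
          ∂(volume : Measure (R3 × R3)))
        (nhdsWithin t (Set.Ici (0 : ℝ))) (nhds 0)) ∧
    (∀ t : ℝ, 0 ≤ t →
      ∫ q : R3 × R3, f (t, q.1, q.2) ∂(volume : Measure (R3 × R3)) =
        ∫ q : R3 × R3, f₀ q ∂(volume : Measure (R3 × R3))) := by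
  have hsym : KSym b := by
    obtain ⟨r, _, hr⟩ := hb_sym
    intro v vs ω
    rw [hr, hr, norm_prime, inner_prime, abs_neg]
  have hB : Bn b ≠ ∞ := hb_int.lintegral_lt_top.ne
  obtain ⟨g, hgm, hg, hmild, hfg⟩ := reduce_to_g hb_meas hb_nonneg hB hf_meas hf_bd hf_mild
  have hI0 : ∫⁻ q, ENNReal.ofReal (f₀ q) ≠ ∞ := hf₀_int.lintegral_lt_top.ne
  have hgi := fun t ht => g_integrable hb_meas hb_nonneg hsym hB hgm hg hf₀_meas hI0 hmild t ht
  refine ⟨fun t ht => (hgi t ht).congr ?_, fun t ht => ?_, fun t ht => ?_⟩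
  · filter_upwards [hfg t ht] with q hq using hq.symm
  · have h1 := g_cont hb_meas hb_nonneg hsym hB hgm hg hf₀_meas hI0 hmild t ht
    have h2 := (ENNReal.tendsto_toReal ENNReal.zero_ne_top).comp h1
    rw [ENNReal.toReal_zero] at h2
    refine h2.congr' ?_
    filter_upwards [self_mem_nhdsWithin] with s hs
    have e1 : ∫ q : R3 × R3, |f (s, q.1, q.2) - f (t, q.1, q.2)| =
        ∫ q : R3 × R3, ‖g (s, q) - g (t, q)‖ := by
      refine integral_congr_ae ?_
      filter_upwards [hfg t ht, hfg s hs] with q hq hq'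
      rw [Real.norm_eq_abs, ← hq, ← hq']
    rw [e1, integral_norm_eq_lintegral_enorm (by fun_prop)]
    rfl
  · rw [← g_mass hb_meas hb_nonneg hsym hB hgm hg hf₀_meas hf₀_int hmild t ht]
    exact integral_congr_ae (hfg t ht)
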